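/- arXiv:2407.08771 — 2 statements merged into one kernel-verified Lean document; each statement's English description precedes it below -/
import Mathlib

section
/- For every real ε > 0 there exists an integer k ≥ 4 such that the tensor product 3-graph F̃_k satisfies π_co(F̃_k) ≤ ε. -/
open Finset

structure ThreeGraph (V : Type*) where
  edges : Finset (Finset V)
  card_eq : ∀ e ∈ edges, e.card = 3

variable {α β : Type*}

/-- `H` contains a copy of `F`. -/
def HasCopy [DecidableEq β] (H : ThreeGraph β) (F : ThreeGraph α) : Prop :=
  ∃ φ : α → β, Function.Injective φ ∧ ∀ e ∈ F.edges, e.image φ ∈ H.edges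

/-- The codegree of a pair of vertices. -/
def codeg [DecidableEq β] [Fintype β] (H : ThreeGraph β) (u v : β) : ℕ :=
  (Finset.univ.filter (fun w => ({u, v, w} : Finset β) ∈ H.edges)).card

/-- The codegree Turán density of a 3-graph `F`. -/
noncomputable def piCo (F : ThreeGraph α) : ℝ :=
  sSup {x : ℝ | 0 ≤ x ∧ x ≤ 1 ∧ ∀ n₀ : ℕ, ∃ n : ℕ, n₀ ≤ n ∧ ∃ H : ThreeGraph (Fin n),
    ¬ HasCopy H F ∧ ∀ u v : Fin n, u ≠ v → x * n ≤ (codeg H u v : ℝ)}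

/-- An `n`-vertex 3-graph is uniformly `(d, η)`-dense. -/
def UniformlyDense {n : ℕ} (H : ThreeGraph (Fin n)) (d η : ℝ) : Prop :=
  ∀ U : Finset (Fin n),
    d * (U.card.choose 3 : ℝ) - η * (n : ℝ) ^ 3 ≤ ((H.edges.filter (fun e => e ⊆ U)).card : ℝ)

/-- The uniform Turán density of a 3-graph `F`. -/
noncomputable def piUnif (F : ThreeGraph α) : ℝ :=
  sSup {d : ℝ | 0 ≤ d ∧ d ≤ 1 ∧ ∀ η : ℝ, 0 < η → ∀ n₀ : ℕ, ∃ n : ℕ, n₀ ≤ n ∧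
    ∃ H : ThreeGraph (Fin n), ¬ HasCopy H F ∧ UniformlyDense H d η}

/-- `f` is a layered function of the 3-graph with edge set `E`. -/
def IsLayeredFunction [DecidableEq α] (E : Finset (Finset α)) (f : α → ℕ) : Prop :=
  (∀ e ∈ E, ∃ w ∈ e, ∀ u ∈ e, u ≠ w → f u < f w) ∧
  (∀ e₁ ∈ E, ∀ e₂ ∈ E, e₁.sup f = e₂.sup f → Multiset.map f e₁.val = Multiset.map f e₂.val) ∧
  (∀ e₁ ∈ E, ∀ e₂ ∈ E, ∀ u v w u' v' w' : α,
    u ≠ v → u ≠ w → v ≠ w → u' ≠ v' → u' ≠ w' → v' ≠ w' →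
    e₁ = {u, v, w} → e₂ = {u', v', w'} →
    f u = f u' → f v = f v' → f w = f w')

/-- A 3-graph is layered if it admits a layered function. -/
def IsLayered [DecidableEq α] (F : ThreeGraph α) : Prop :=
  ∃ f : α → ℕ, IsLayeredFunction F.edges f

/-- The collection of all 3-graphs (given by their edge sets) on vertex set `Fin k`
with minimum codegree at least `2`. -/
abbrev CodegTwoFamily (k : ℕ) : Type :=
  {E : Finset (Finset (Fin k)) //
    (∀ e ∈ E, e.card = 3) ∧
    ∀ u v : Fin k, u ≠ v →
      2 ≤ (Finset.univ.filter (fun w => ({u, v, w} : Finset (Fin k)) ∈ E)).card}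

noncomputable instance (k : ℕ) : Fintype (CodegTwoFamily k) := Fintype.ofFinite _

/-- The tensor product `F̃_k` of all 3-graphs on `{1, …, k}` with minimum codegree at
least two: vertices are tuples (functions on the index family), and three vertices form
an edge iff their coordinates form an edge in every member of the family. -/
noncomputable def tensorGraph (k : ℕ) : ThreeGraph (CodegTwoFamily k → Fin k) where
  edges := Finset.univ.filter (fun e : Finset (CodegTwoFamily k → Fin k) =>
    e.card = 3 ∧ ∀ i : CodegTwoFamily k, e.image (fun x => x i) ∈ i.val)
  card_eq := fun e he => (Finset.mem_filter.mp he).2.1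

section Counting

variable {ι V : Type} [Fintype ι] [DecidableEq ι] [Fintype V] [DecidableEq V]

/-- At most a `|ι|² / |V|` fraction of all maps `ι → V` fails to be injective. -/
lemma card_not_injective_mul_le :
    #{f : ι → V | ¬ Function.Injective f} * Fintype.card V ≤
      Fintype.card ι ^ 2 * Fintype.card V ^ Fintype.card ι := by
  have hpair : ∀ p : ι × ι, p.1 ≠ p.2 →
      #{f : ι → V | f p.1 = f p.2} * Fintype.card V ≤ Fintype.card V ^ Fintype.card ι := by
    rintro ⟨i, j⟩ hij
    rw [← Fintype.card_fun, ← Finset.card_univ (α := V), ← Finset.card_product,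
      ← Finset.card_univ (α := ι → V)]
    refine Finset.card_le_card_of_injOn (fun x => Function.update x.1 i x.2)
      (fun _ _ => by simp) ?_
    rintro ⟨f, a⟩ hf ⟨g, b⟩ hg h
    simp only [coe_product, Set.mem_prod, mem_coe, mem_filter, mem_univ, true_and,
      and_true] at hf hg h
    have hz : ∀ z, z ≠ i → f z = g z := fun z hz => by
      simpa [Function.update_of_ne hz] using congrFun h z
    have hab : a = b := by simpa using congrFun h i
    have hfg : f = g := by
      funext z
      by_cases hzi : z = i
      · rw [hzi, hf, hg]
        exact hz j (Ne.symm hij)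
      · exact hz z hzi
    rw [hab, hfg]
  have hsub : ({f : ι → V | ¬ Function.Injective f} : Finset (ι → V)) ⊆
      ({p : ι × ι | p.1 ≠ p.2} : Finset (ι × ι)).biUnion fun p => {f | f p.1 = f p.2} := by
    intro f hf
    simp only [Function.Injective, mem_filter, mem_univ, true_and, not_forall] at hf
    obtain ⟨i, j, hfij, hij⟩ := hf
    simp only [mem_biUnion, mem_filter, mem_univ, true_and]
    exact ⟨(i, j), hij, hfij⟩
  calc #{f : ι → V | ¬ Function.Injective f} * Fintype.card V
      ≤ (∑ p : ι × ι with p.1 ≠ p.2, #{f : ι → V | f p.1 = f p.2}) * Fintype.card V :=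
        Nat.mul_le_mul_right _ ((card_le_card hsub).trans card_biUnion_le)
    _ ≤ ∑ p : ι × ι with p.1 ≠ p.2, Fintype.card V ^ Fintype.card ι := by
        rw [Finset.sum_mul]
        exact Finset.sum_le_sum fun p hp => hpair p (by simpa using hp)
    _ ≤ ∑ _p : ι × ι, Fintype.card V ^ Fintype.card ι :=
        Finset.sum_le_sum_of_subset (filter_subset _ _)
    _ = Fintype.card ι ^ 2 * Fintype.card V ^ Fintype.card ι := by
        simp [sq]

/-- In a relation of density `c` between `V` and `X`, some injective family `T → V` has a common
neighbourhood of density at least `c ^ |T| / 2`. -/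
lemma exists_injective_dense_common_nbhd {T X : Type} [Fintype T] [DecidableEq T] [Nonempty T]
    [Fintype X] [Nonempty X] [Nonempty V] (D : X → Finset V) {c : ℝ} (hc : 0 < c)
    (hV : 2 * (Fintype.card T : ℝ) ^ 2 < c ^ Fintype.card T * Fintype.card V)
    (hD : c * (Fintype.card V * Fintype.card X) ≤ ∑ x, (#(D x) : ℝ)) :
    ∃ f : T → V, Function.Injective f ∧
      c ^ Fintype.card T / 2 * Fintype.card X ≤ (#{x : X | ∀ i, f i ∈ D x} : ℝ) := by
  classical
  by_contra! hcon
  set t := Fintype.card T with ht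
  set n : ℝ := (Fintype.card V : ℝ) with hn
  set m : ℝ := (Fintype.card X : ℝ) with hm
  have hnpos : 0 < n := by rw [hn]; exact_mod_cast Fintype.card_pos
  have hmpos : 0 < m := by rw [hm]; exact_mod_cast Fintype.card_pos
  have hdouble : ∑ x, (#(D x) : ℝ) ^ t = ∑ f : T → V, (#{x : X | ∀ i, f i ∈ D x} : ℝ) := by
    have h := Finset.sum_card_bipartiteAbove_eq_sum_card_bipartiteBelow
      (s := (univ : Finset X)) (t := (univ : Finset (T → V))) (fun x f => ∀ i, f i ∈ D x)
    have hx : ∀ x : X, #((univ : Finset (T → V)).bipartiteAbove (fun x f => ∀ i, f i ∈ D x) x)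
        = #(D x) ^ t := by
      intro x
      have : (univ : Finset (T → V)).bipartiteAbove (fun x f => ∀ i, f i ∈ D x) x
          = Fintype.piFinset fun _ : T => D x := by
        ext f; simp [Finset.bipartiteAbove]
      simp [this, Fintype.card_piFinset, ht]
    rw [Finset.sum_congr rfl fun x _ => hx x] at h
    exact_mod_cast h
  have hlower : c ^ t * n ^ t * m ≤ ∑ x, (#(D x) : ℝ) ^ t := by
    obtain ⟨r, hr⟩ : ∃ r, t = r + 1 := ⟨t - 1, by have : 0 < t := Fintype.card_pos; omega⟩
    have h := pow_sum_div_card_le_sum_pow (s := (univ : Finset X)) (f := fun x => (#(D x) : ℝ))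
      (fun _ _ => Nat.cast_nonneg _) r
    rw [hr]
    refine le_trans ?_ h
    rw [Finset.card_univ, le_div_iff₀ (by positivity)]
    calc c ^ (r + 1) * n ^ (r + 1) * m * m ^ r = (c * (n * m)) ^ (r + 1) := by ring
      _ ≤ _ := by gcongr
  have hinj : (#{f : T → V | ¬ Function.Injective f} : ℝ) * n ≤ t ^ 2 * n ^ t := by
    rw [hn]
    exact_mod_cast card_not_injective_mul_le (ι := T) (V := V)
  have hupper : ∑ f : T → V, (#{x : X | ∀ i, f i ∈ D x} : ℝ) ≤
      n ^ t * (c ^ t / 2 * m) + #{f : T → V | ¬ Function.Injective f} * m := by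
    have hpt : ∀ f : T → V, (#{x : X | ∀ i, f i ∈ D x} : ℝ) ≤
        c ^ t / 2 * m + if ¬ Function.Injective f then m else 0 := by
      intro f
      by_cases hf : Function.Injective f
      · simpa [hf] using (hcon f hf).le
      · have h : (#{x : X | ∀ i, f i ∈ D x} : ℝ) ≤ m := by
          rw [hm]
          exact_mod_cast Finset.card_le_univ _
        simp only [hf, not_false_eq_true, if_true]
        have : 0 ≤ c ^ t / 2 * m := by positivity
        linarith
    refine (Finset.sum_le_sum fun f _ => hpt f).trans (le_of_eq ?_)
    rw [Finset.sum_add_distrib, ← Finset.sum_filter]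
    simp [Finset.card_univ, hn, ht]
  have hsmall : (#{f : T → V | ¬ Function.Injective f} : ℝ) < c ^ t / 2 * n ^ t := by
    refine lt_of_mul_lt_mul_right (hinj.trans_lt ?_) hnpos.le
    have : 0 < n ^ t := by positivity
    nlinarith
  have := mul_lt_mul_of_pos_right hsmall hmpos
  rw [hdouble] at hlower
  linarith

/-- A dense set of `k`-tuples contains a complete `k`-partite box with parts indexed by `T`. -/
lemma exists_box_of_dense (T : Type) [Fintype T] [DecidableEq T] [Nonempty T] (k : ℕ) :
    ∀ c : ℝ, 0 < c → ∃ N : ℕ, ∀ (V : Type) [Fintype V] [DecidableEq V], N ≤ Fintype.card V →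
      ∀ S : Finset (Fin k → V), c * (Fintype.card V : ℝ) ^ k ≤ #S →
        ∃ A : Fin k → T → V, (∀ j, Function.Injective (A j)) ∧
          ∀ s : Fin k → T, (fun j => A j (s j)) ∈ S := by
  induction k with
  | zero =>
    intro c hc
    refine ⟨0, fun V _ _ _ S hS => ⟨fun j => j.elim0, fun j => j.elim0, fun s => ?_⟩⟩
    have hpos : (0 : ℝ) < #S := lt_of_lt_of_le (by simpa using hc) hS
    obtain ⟨x, hx⟩ := Finset.card_pos.mp (by exact_mod_cast hpos : 0 < #S)
    rwa [Subsingleton.elim (fun j => _) x]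
  | succ k ih =>
    intro c hc
    obtain ⟨N, hN⟩ := ih (c ^ Fintype.card T / 2) (by positivity)
    obtain ⟨M, hM⟩ := exists_nat_gt (2 * (Fintype.card T : ℝ) ^ 2 / c ^ Fintype.card T)
    refine ⟨max N (M + 1), fun V _ _ hV S hS => ?_⟩
    have hMV : (M : ℝ) ≤ Fintype.card V := by
      exact_mod_cast (Nat.le_succ M).trans ((le_max_right _ _).trans hV)
    have : Nonempty V := Fintype.card_pos_iff.mp (by have := le_max_right N (M + 1); omega)
    have hsum : ∑ x : Fin k → V, #{v : V | (Fin.cons v x : Fin (k + 1) → V) ∈ S} = #S := by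
      have h : ∀ x : Fin k → V, #{v : V | (Fin.cons v x : Fin (k + 1) → V) ∈ S} =
          #{g ∈ S | Fin.tail g = x} := by
        intro x
        refine Finset.card_bij (fun v _ => (Fin.cons v x : Fin (k + 1) → V)) ?_ ?_ ?_
        · intro v hv
          simpa using hv
        · intro v _ w _ h
          exact (Fin.cons_injective2 h).1
        · intro g hg
          rw [mem_filter] at hg
          refine ⟨g 0, ?_, ?_⟩
          · simp [← hg.2, hg.1]
          · simp [← hg.2]
      rw [Finset.sum_congr rfl fun x _ => h x]
      exact (Finset.card_eq_sum_card_fiberwise fun _ _ => mem_coe.mpr (mem_univ _)).symm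
    obtain ⟨f, hf, hdense⟩ := exists_injective_dense_common_nbhd (T := T)
      (fun x : Fin k → V => {v : V | (Fin.cons v x : Fin (k + 1) → V) ∈ S}) hc
      (by
        rw [div_lt_iff₀ (by positivity)] at hM
        refine hM.trans_le ?_
        rw [mul_comm]
        gcongr)
      (by
        have hsum' : ∑ x : Fin k → V, (#{v : V | (Fin.cons v x : Fin (k + 1) → V) ∈ S} : ℝ)
            = #S := by exact_mod_cast hsum
        rw [hsum']
        refine le_trans (le_of_eq ?_) hS
        simp only [Fintype.card_fun, Fintype.card_fin, Nat.cast_pow]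
        ring)
    obtain ⟨A, hA, hAS⟩ := hN V ((le_max_left _ _).trans hV) _
      (by simpa only [Fintype.card_fun, Fintype.card_fin, Nat.cast_pow] using hdense)
    refine ⟨Fin.cons f A, fun j => ?_, fun s => ?_⟩
    · refine Fin.cases ?_ (fun j => ?_) j
      · simpa using hf
      · simpa using hA j
    · have h := hAS fun j => s j.succ
      simp only [mem_filter, mem_univ, true_and] at h
      convert h (s 0) using 1
      funext j
      refine Fin.cases ?_ (fun j => ?_) j <;> simp

end Counting

section Sampling

variable {V : Type} [DecidableEq V] {k : ℕ}

/-- Few tuples have the property that all entries outside three positions `u, v, w` avoid the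
neighbourhood of the pair at positions `u, v`. -/
lemma card_avoiding_le [Fintype V] (H : ThreeGraph V) {ε : ℝ} (hε : ε ≤ 1)
    (hH : ∀ a b : V, a ≠ b → ε * Fintype.card V ≤ codeg H a b) {u v w : Fin k}
    (huv : u ≠ v) (huw : u ≠ w) (hvw : v ≠ w) :
    (#{g : Fin k → V | g u ≠ g v ∧
        ∀ z, z ∉ ({u, v, w} : Finset (Fin k)) → ({g u, g v, g z} : Finset V) ∉ H.edges} : ℝ) ≤
      (1 - ε) ^ (k - 3) * (Fintype.card V : ℝ) ^ k := by
  set n : ℝ := (Fintype.card V : ℝ) with hn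
  have h3 : #({u, v, w} : Finset (Fin k)) = 3 :=
    Finset.card_eq_three.mpr ⟨u, v, w, huv, huw, hvw, rfl⟩
  have hk : 3 ≤ k := by simpa [h3] using Finset.card_le_univ ({u, v, w} : Finset (Fin k))
  let P : V × V → Fin k → Finset V := fun p z =>
    if z = u then {p.1} else if z = v then {p.2} else if z = w then univ else
      univ.filter fun c => ({p.1, p.2, c} : Finset V) ∉ H.edges
  have hsub : ({g : Fin k → V | g u ≠ g v ∧ ∀ z, z ∉ ({u, v, w} : Finset (Fin k)) →
      ({g u, g v, g z} : Finset V) ∉ H.edges} : Finset (Fin k → V)) ⊆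
      ({p : V × V | p.1 ≠ p.2} : Finset (V × V)).biUnion fun p => Fintype.piFinset (P p) := by
    intro g hg
    simp only [mem_filter, mem_univ, true_and] at hg
    simp only [mem_biUnion, mem_filter, mem_univ, true_and, Fintype.mem_piFinset]
    refine ⟨(g u, g v), hg.1, fun z => ?_⟩
    by_cases hzu : z = u
    · simp [P, hzu]
    by_cases hzv : z = v
    · simp [P, hzv, huv.symm]
    by_cases hzw : z = w
    · simp [P, hzw, huw.symm, hvw.symm]
    · simpa [P, hzu, hzv, hzw] using hg.2 z (by simp [hzu, hzv, hzw])
  have hcard : ∀ p : V × V, p.1 ≠ p.2 →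
      (#(Fintype.piFinset (P p)) : ℝ) ≤ n * ((1 - ε) * n) ^ (k - 3) := by
    intro p hp
    rw [Fintype.card_piFinset, ← Finset.prod_mul_prod_compl {u, v, w}]
    have hfirst : ∏ z ∈ ({u, v, w} : Finset (Fin k)), #(P p z) = Fintype.card V := by
      rw [Finset.prod_insert (by simp [huv, huw]), Finset.prod_insert (by simp [hvw]),
        Finset.prod_singleton]
      simp [P, huv.symm, huw.symm, hvw.symm]
    have hmiss : (#{c : V | ({p.1, p.2, c} : Finset V) ∉ H.edges} : ℝ) ≤ (1 - ε) * n := by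
      have h := Finset.card_filter_add_card_filter_not (s := (univ : Finset V))
        (fun c => ({p.1, p.2, c} : Finset V) ∈ H.edges)
      have h' : (codeg H p.1 p.2 : ℝ) + #{c : V | ({p.1, p.2, c} : Finset V) ∉ H.edges} = n := by
        rw [hn, ← Finset.card_univ]
        exact_mod_cast h
      linarith [hH p.1 p.2 hp]
    have hsecond : ∏ z ∈ ({u, v, w} : Finset (Fin k))ᶜ, #(P p z) =
        #{c : V | ({p.1, p.2, c} : Finset V) ∉ H.edges} ^ (k - 3) := by
      have hcompl : #({u, v, w} : Finset (Fin k))ᶜ = k - 3 := by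
        rw [Finset.card_compl, h3, Fintype.card_fin]
      rw [← hcompl, ← Finset.prod_const]
      refine Finset.prod_congr rfl fun z hz => ?_
      simp only [mem_compl, mem_insert, mem_singleton, not_or] at hz
      simp [P, hz.1, hz.2.1, hz.2.2]
    rw [hfirst, hsecond]
    push_cast
    gcongr
  have hnn : (0 : ℝ) ≤ n * ((1 - ε) * n) ^ (k - 3) := by
    have : 0 ≤ 1 - ε := by linarith
    positivity
  calc (#{g : Fin k → V | g u ≠ g v ∧ ∀ z, z ∉ ({u, v, w} : Finset (Fin k)) →
        ({g u, g v, g z} : Finset V) ∉ H.edges} : ℝ)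
      ≤ ∑ p : V × V with p.1 ≠ p.2, (#(Fintype.piFinset (P p)) : ℝ) := by
        exact_mod_cast (card_le_card hsub).trans card_biUnion_le
    _ ≤ ∑ p : V × V with p.1 ≠ p.2, n * ((1 - ε) * n) ^ (k - 3) :=
        Finset.sum_le_sum fun p hp => hcard p (by simpa using hp)
    _ ≤ ∑ _p : V × V, n * ((1 - ε) * n) ^ (k - 3) :=
        Finset.sum_le_sum_of_subset_of_nonneg (filter_subset _ _) fun _ _ _ => hnn
    _ = (1 - ε) ^ (k - 3) * n ^ (3 + (k - 3)) := by
        simp only [sum_const, Finset.card_univ, Fintype.card_prod, nsmul_eq_mul, Nat.cast_mul,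
          ← hn, mul_pow, pow_add]
        ring
    _ = (1 - ε) ^ (k - 3) * n ^ k := by rw [Nat.add_sub_cancel' hk]

/-- The edge set on `Fin k` induced by a tuple of vertices of `H`. -/
def inducedEdges (H : ThreeGraph V) (g : Fin k → V) : Finset (Finset (Fin k)) :=
  {e | e.card = 3 ∧ e.image g ∈ H.edges}

/-- `g` is injective and the 3-graph it induces has minimum codegree at least two. -/
def InducesCodegTwo (H : ThreeGraph V) (g : Fin k → V) : Prop :=
  Function.Injective g ∧ ∀ u v : Fin k, u ≠ v →
    2 ≤ #{w : Fin k | ({u, v, w} : Finset (Fin k)) ∈ inducedEdges H g}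

lemma mem_inducedEdges_triple {H : ThreeGraph V} {g : Fin k → V} (hg : Function.Injective g)
    (u v w : Fin k) :
    ({u, v, w} : Finset (Fin k)) ∈ inducedEdges H g ↔ ({g u, g v, g w} : Finset V) ∈ H.edges := by
  have himage : ({u, v, w} : Finset (Fin k)).image g = {g u, g v, g w} := by
    simp [Finset.image_insert]
  simp only [inducedEdges, mem_filter, mem_univ, true_and, himage]
  refine ⟨fun h => h.2, fun h => ⟨?_, h⟩⟩
  rw [← Finset.card_image_of_injective _ hg, himage]
  exact H.card_eq _ h

/-- An injective tuple that fails to induce codegree two avoids the neighbourhood of one of its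
pairs in all but one further position. -/
lemma exists_avoiding_of_not_inducesCodegTwo {H : ThreeGraph V} {g : Fin k → V} (hk : 3 ≤ k)
    (hg : Function.Injective g) (h : ¬ InducesCodegTwo H g) :
    ∃ u v w : Fin k, u ≠ v ∧ u ≠ w ∧ v ≠ w ∧ g u ≠ g v ∧
      ∀ z, z ∉ ({u, v, w} : Finset (Fin k)) → ({g u, g v, g z} : Finset V) ∉ H.edges := by
  simp only [InducesCodegTwo, hg, true_and, not_forall, not_le] at h
  obtain ⟨u, v, huv, hcard⟩ := h
  simp only [mem_inducedEdges_triple hg] at hcard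
  by_cases hex : ∃ w, ({g u, g v, g w} : Finset V) ∈ H.edges
  · obtain ⟨w, hw⟩ := hex
    have h3 := H.card_eq _ hw
    have huw : u ≠ w := by
      rintro rfl
      have : ({g u, g v, g u} : Finset V) = {g u, g v} := by ext; simp; tauto
      rw [this] at h3
      have := Finset.card_le_two (a := g u) (b := g v)
      omega
    have hvw : v ≠ w := by
      rintro rfl
      have : ({g u, g v, g v} : Finset V) = {g u, g v} := by ext; simp
      rw [this] at h3
      have := Finset.card_le_two (a := g u) (b := g v)
      omega
    refine ⟨u, v, w, huv, huw, hvw, hg.ne huv, fun z hz hmem => hz ?_⟩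
    have hzw := Finset.card_le_one.mp (Nat.le_of_lt_succ hcard) z (by simpa using hmem) w
      (by simpa using hw)
    simp [hzw]
  · push Not at hex
    obtain ⟨w, hw⟩ : ∃ w, w ∉ ({u, v} : Finset (Fin k)) := by
      by_contra! hall
      have h1 : #(univ : Finset (Fin k)) ≤ #({u, v} : Finset (Fin k)) :=
        Finset.card_le_card fun z _ => hall z
      have h2 := Finset.card_le_two (a := u) (b := v)
      simp only [Finset.card_univ, Fintype.card_fin] at h1
      omega
    simp only [mem_insert, mem_singleton, not_or] at hw
    exact ⟨u, v, w, huv, Ne.symm hw.1, Ne.symm hw.2, hg.ne huv, fun z _ => hex z⟩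

open Classical in
/-- At least half of all `k`-tuples of a 3-graph of large minimum codegree induce a 3-graph of
minimum codegree at least two. -/
lemma half_le_card_inducesCodegTwo [Fintype V] (H : ThreeGraph V) {ε : ℝ} (hε : ε ≤ 1) (hk : 3 ≤ k)
    (hkε : (k : ℝ) ^ 3 * (1 - ε) ^ (k - 3) ≤ 1 / 4) (hV : 4 * k ^ 2 ≤ Fintype.card V)
    (hH : ∀ a b : V, a ≠ b → ε * Fintype.card V ≤ codeg H a b) :
    1 / 2 * (Fintype.card V : ℝ) ^ k ≤ #{g : Fin k → V | InducesCodegTwo H g} := by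
  set n : ℝ := (Fintype.card V : ℝ) with hn
  let Q : Fin k × Fin k × Fin k → Finset (Fin k → V) := fun p =>
    {g | g p.1 ≠ g p.2.1 ∧ ∀ z, z ∉ ({p.1, p.2.1, p.2.2} : Finset (Fin k)) →
      ({g p.1, g p.2.1, g z} : Finset V) ∉ H.edges}
  let I : Finset (Fin k × Fin k × Fin k) := {p | p.1 ≠ p.2.1 ∧ p.1 ≠ p.2.2 ∧ p.2.1 ≠ p.2.2}
  have hcover : (univ : Finset (Fin k → V)) ⊆
      (univ.filter (InducesCodegTwo H) ∪ univ.filter (¬ Function.Injective ·)) ∪ I.biUnion Q := by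
    intro g _
    by_cases hg : Function.Injective g
    · by_cases h : InducesCodegTwo H g
      · simp [h]
      · obtain ⟨u, v, w, huv, huw, hvw, h⟩ := exists_avoiding_of_not_inducesCodegTwo hk hg h
        refine mem_union_right _ (mem_biUnion.mpr ⟨(u, v, w), ?_, ?_⟩)
        · simp [I, huv, huw, hvw]
        · exact mem_filter.mpr ⟨mem_univ _, h⟩
    · simp [hg]
  have hcount : n ^ k ≤ #{g : Fin k → V | InducesCodegTwo H g} +
      #{g : Fin k → V | ¬ Function.Injective g} + ∑ p ∈ I, (#(Q p) : ℝ) := by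
    have h := (card_le_card hcover).trans ((card_union_le _ _).trans
      (Nat.add_le_add (card_union_le _ _) card_biUnion_le))
    rw [Finset.card_univ, Fintype.card_fun, Fintype.card_fin] at h
    rw [hn]
    exact_mod_cast h
  have hkpos : (0 : ℝ) < (k : ℝ) ^ 2 := by
    have : 0 < k := by omega
    positivity
  have hVn : 4 * (k : ℝ) ^ 2 ≤ n := by rw [hn]; exact_mod_cast hV
  have hinj : (#{g : Fin k → V | ¬ Function.Injective g} : ℝ) ≤ 1 / 4 * n ^ k := by
    have h : (#{g : Fin k → V | ¬ Function.Injective g} : ℝ) * n ≤ k ^ 2 * n ^ k := by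
      have := card_not_injective_mul_le (ι := Fin k) (V := V)
      rw [Fintype.card_fin] at this
      rw [hn]
      exact_mod_cast this
    have hnpos : 0 < n := by linarith
    refine le_of_mul_le_mul_right (h.trans ?_) hnpos
    have : 0 < n ^ k := by positivity
    nlinarith
  have hQ : ∑ p ∈ I, (#(Q p) : ℝ) ≤ 1 / 4 * n ^ k := by
    have hnn : (0 : ℝ) ≤ (1 - ε) ^ (k - 3) * n ^ k := by
      have : 0 ≤ 1 - ε := by linarith
      positivity
    calc ∑ p ∈ I, (#(Q p) : ℝ) ≤ ∑ _p ∈ I, (1 - ε) ^ (k - 3) * n ^ k := by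
          refine Finset.sum_le_sum fun p hp => ?_
          simp only [I, mem_filter, mem_univ, true_and] at hp
          exact card_avoiding_le H hε hH hp.1 hp.2.1 hp.2.2
      _ ≤ ∑ _p : Fin k × Fin k × Fin k, (1 - ε) ^ (k - 3) * n ^ k :=
          Finset.sum_le_sum_of_subset_of_nonneg (subset_univ _) fun _ _ _ => hnn
      _ = (k : ℝ) ^ 3 * (1 - ε) ^ (k - 3) * n ^ k := by
          simp only [sum_const, Finset.card_univ, Fintype.card_prod, Fintype.card_fin,
            nsmul_eq_mul, Nat.cast_mul]
          ring
      _ ≤ 1 / 4 * n ^ k := by gcongr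
  linarith

/-- Some fixed 3-graph of minimum codegree two is hosted by a positive fraction of the
injective tuples. -/
lemma exists_dense_codegTwoFamily [Fintype V] [Nonempty V] (H : ThreeGraph V) {c : ℝ} (hc : 0 < c)
    [DecidablePred fun g : Fin k → V => InducesCodegTwo H g]
    (hgood : c * (Fintype.card V : ℝ) ^ k ≤ #{g : Fin k → V | InducesCodegTwo H g}) :
    ∃ E : CodegTwoFamily k, c / (Fintype.card (CodegTwoFamily k) + 1) * (Fintype.card V : ℝ) ^ k ≤
      #{g : Fin k → V | Function.Injective g ∧ ∀ e ∈ E.val, e.image g ∈ H.edges} := by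
  by_contra! hcon
  have hpow : 0 < (Fintype.card V : ℝ) ^ k := by
    have : 0 < Fintype.card V := Fintype.card_pos
    positivity
  have hcover : ({g : Fin k → V | InducesCodegTwo H g} : Finset (Fin k → V)) ⊆
      (univ : Finset (CodegTwoFamily k)).biUnion fun E =>
        {g | Function.Injective g ∧ ∀ e ∈ E.val, e.image g ∈ H.edges} := by
    intro g hg
    rw [mem_filter] at hg
    refine mem_biUnion.mpr ⟨⟨inducedEdges H g, fun e he => (mem_filter.mp he).2.1, hg.2.2⟩,
      mem_univ _, mem_filter.mpr ⟨mem_univ _, hg.2.1, fun e he => (mem_filter.mp he).2.2⟩⟩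
  have hle : (#{g : Fin k → V | InducesCodegTwo H g} : ℝ) ≤ ∑ E : CodegTwoFamily k,
      (#{g : Fin k → V | Function.Injective g ∧ ∀ e ∈ E.val, e.image g ∈ H.edges} : ℝ) := by
    exact_mod_cast (card_le_card hcover).trans card_biUnion_le
  have hsum := Finset.sum_le_sum fun (E : CodegTwoFamily k) (_ : E ∈ univ) => (hcon E).le
  rw [Finset.sum_const, Finset.card_univ, nsmul_eq_mul] at hsum
  have hlt : (Fintype.card (CodegTwoFamily k) : ℝ) *
      (c / (Fintype.card (CodegTwoFamily k) + 1) * (Fintype.card V : ℝ) ^ k) <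
      c * (Fintype.card V : ℝ) ^ k := by
    rw [← mul_assoc]
    refine mul_lt_mul_of_pos_right ?_ hpow
    rw [mul_div_assoc', div_lt_iff₀ (by positivity)]
    linarith
  linarith

/-- A blow-up of a member of the family contains the tensor product. -/
lemma hasCopy_tensorGraph_of_box (H : ThreeGraph V) (E : CodegTwoFamily k)
    (A : Fin k → (CodegTwoFamily k → Fin k) → V) (hA : ∀ j, Function.Injective (A j))
    (hbox : ∀ s : Fin k → CodegTwoFamily k → Fin k,
      Function.Injective (fun j => A j (s j)) ∧
        ∀ e ∈ E.val, e.image (fun j => A j (s j)) ∈ H.edges) :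
    HasCopy H (tensorGraph k) := by
  refine ⟨fun x => A (x E) x, fun x y hxy => ?_, fun e he => ?_⟩
  · by_cases h : x E = y E
    · simp only [h] at hxy
      exact hA _ hxy
    · refine absurd ((hbox fun j => if j = x E then x else y).1 (a₁ := x E) (a₂ := y E) ?_) h
      simpa [Ne.symm h] using hxy
  · obtain ⟨-, hcard, hmem⟩ := mem_filter.mp he
    have hinj : Set.InjOn (fun x : CodegTwoFamily k → Fin k => x E) e :=
      Finset.card_image_iff.mp ((E.2.1 _ (hmem E)).trans hcard.symm)
    obtain ⟨x₀, -⟩ := Finset.card_pos.mp (by omega : 0 < #e)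
    have : Nonempty (CodegTwoFamily k → Fin k) := ⟨x₀⟩
    let s : Fin k → CodegTwoFamily k → Fin k := Function.invFunOn (fun x => x E) e
    have h := (hbox s).2 _ (hmem E)
    rw [Finset.image_image] at h
    convert h using 1
    refine Finset.image_congr fun x hx => ?_
    have hs : s (x E) = x := hinj.leftInvOn_invFunOn hx
    simp [hs]

end Sampling

lemma exists_sample_size {q : ℝ} (hq₀ : 0 ≤ q) (hq₁ : q < 1) :
    ∃ k : ℕ, 4 ≤ k ∧ (k : ℝ) ^ 3 * q ^ (k - 3) ≤ 1 / 4 := by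
  have h := (tendsto_pow_const_mul_const_pow_of_abs_lt_one 3
    (by rwa [abs_of_nonneg hq₀] : |q| < 1)).eventually
    (gt_mem_nhds (by norm_num : (0 : ℝ) < 1 / 256))
  obtain ⟨m, hm, hm1⟩ := (h.and (Filter.eventually_ge_atTop 1)).exists
  refine ⟨m + 3, by omega, ?_⟩
  have hm1' : (1 : ℝ) ≤ m := by exact_mod_cast hm1
  rw [Nat.add_sub_cancel]
  push_cast
  calc ((m : ℝ) + 3) ^ 3 * q ^ m ≤ (4 * (m : ℝ)) ^ 3 * q ^ m := by gcongr; linarith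
    _ = 64 * ((m : ℝ) ^ 3 * q ^ m) := by ring
    _ ≤ 1 / 4 := by linarith

/-- For every `ε > 0` there is `k ≥ 4` such that `π_co(F̃_k) ≤ ε`. -/
theorem stmt6 (ε : ℝ) (hε : 0 < ε) :
    ∃ k : ℕ, 4 ≤ k ∧ piCo (tensorGraph k) ≤ ε := by
  classical
  by_cases h1 : 1 ≤ ε
  · exact ⟨4, le_rfl, Real.sSup_le (fun x hx => hx.2.1.trans h1) hε.le⟩
  push Not at h1
  obtain ⟨k, hk, hkε⟩ := exists_sample_size (q := 1 - ε) (by linarith) (by linarith)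
  refine ⟨k, hk, Real.sSup_le (fun x hx => ?_) hε.le⟩
  obtain ⟨-, -, hx⟩ := hx
  by_contra! hlt
  have : Nonempty (Fin k) := ⟨⟨0, by omega⟩⟩
  obtain ⟨N, hN⟩ := exists_box_of_dense (CodegTwoFamily k → Fin k) k
    (1 / 2 / (Fintype.card (CodegTwoFamily k) + 1)) (by positivity)
  obtain ⟨n, hn, H, hfree, hH⟩ := hx (max N (4 * k ^ 2))
  have hkn : 4 * k ^ 2 ≤ n := (le_max_right _ _).trans hn
  have : Nonempty (Fin n) := ⟨⟨0, lt_of_lt_of_le (by positivity) hkn⟩⟩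
  obtain ⟨E, hE⟩ := exists_dense_codegTwoFamily (k := k) H (by norm_num : (0 : ℝ) < 1 / 2)
    (half_le_card_inducesCodegTwo H h1.le (by omega) hkε (by simpa using hkn) fun a b hab => by
      refine le_trans ?_ (hH a b hab)
      rw [Fintype.card_fin]
      gcongr)
  obtain ⟨A, hA, hAS⟩ := hN (Fin n) (by simpa using (le_max_left _ _).trans hn) _ hE
  exact hfree (hasCopy_tensorGraph_of_box H E A hA fun s => (mem_filter.mp (hAS s)).2)
end

section
/- For every integer k ≥ 4, the tensor product 3-graph F̃_k satisfies π_⸫(F̃_k) ≥ 4/27. -/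
open Finset

variable {α β : Type*}

section Tensor

lemma codegTwoFamily_nonempty {k : ℕ} (hk : 4 ≤ k) : Nonempty (CodegTwoFamily k) := by
  refine ⟨⟨Finset.univ.filter (fun e => e.card = 3), by simp, fun u v huv => ?_⟩⟩
  have hsub : (Finset.univ \ {u, v} : Finset (Fin k)) ⊆ Finset.univ.filter
      (fun w => ({u, v, w} : Finset (Fin k)) ∈ Finset.univ.filter (fun e => e.card = 3)) := by
    intro w hw
    simp only [mem_sdiff, mem_univ, mem_insert, mem_singleton, true_and, not_or] at hw
    simp only [mem_filter, mem_univ, true_and]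
    exact Finset.card_eq_three.2 ⟨u, v, w, huv, Ne.symm hw.1, Ne.symm hw.2, rfl⟩
  refine le_trans ?_ (Finset.card_le_card hsub)
  rw [Finset.card_sdiff_of_subset (Finset.subset_univ _), Finset.card_pair huv, Finset.card_univ,
    Fintype.card_fin]
  omega

/-- A pair of tuples differing in every coordinate lies in two edges of the tensor product whose
third vertices again differ in every coordinate. -/
lemma tensorGraph_exists_two_extensions {k : ℕ} (hk : 4 ≤ k) {x y : CodegTwoFamily k → Fin k}
    (hxy : ∀ i, x i ≠ y i) :
    ∃ z z' : CodegTwoFamily k → Fin k,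
      (∀ i, x i ≠ z i) ∧ (∀ i, y i ≠ z i) ∧ (∀ i, z i ≠ z' i) ∧
      ({x, y, z} : Finset _) ∈ (tensorGraph k).edges ∧
      ({x, y, z'} : Finset _) ∈ (tensorGraph k).edges := by
  obtain ⟨i₀⟩ := codegTwoFamily_nonempty hk
  have hex : ∀ i : CodegTwoFamily k, ∃ w w' : Fin k, w ≠ w' ∧
      ({x i, y i, w} : Finset (Fin k)) ∈ i.val ∧ ({x i, y i, w'} : Finset (Fin k)) ∈ i.val := by
    intro i
    obtain ⟨w, hw, w', hw', hne⟩ := Finset.one_lt_card.1 (i.property.2 _ _ (hxy i))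
    exact ⟨w, w', hne, (mem_filter.1 hw).2, (mem_filter.1 hw').2⟩
  choose z z' hne hz hz' using hex
  have hproper : ∀ t : CodegTwoFamily k → Fin k,
      (∀ i, ({x i, y i, t i} : Finset (Fin k)) ∈ i.val) →
      (∀ i, x i ≠ t i) ∧ (∀ i, y i ≠ t i) ∧ ({x, y, t} : Finset _) ∈ (tensorGraph k).edges := by
    intro t ht
    have hx : ∀ i, x i ≠ t i := fun i h => by
      have h3 := i.property.1 _ (ht i)
      have h2 := Finset.card_le_two (a := t i) (b := y i)
      rw [h, Finset.insert_eq_of_mem (by simp : t i ∈ ({y i, t i} : Finset (Fin k))),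
        Finset.pair_comm] at h3
      omega
    have hy : ∀ i, y i ≠ t i := fun i h => by
      have h3 := i.property.1 _ (ht i)
      have h2 := Finset.card_le_two (a := x i) (b := t i)
      rw [h, Finset.pair_eq_singleton] at h3
      omega
    refine ⟨hx, hy, mem_filter.2 ⟨mem_univ _, ?_, fun i => ?_⟩⟩
    · exact Finset.card_eq_three.2 ⟨x, y, t, fun h => hxy i₀ (congrFun h i₀),
        fun h => hx i₀ (congrFun h i₀), fun h => hy i₀ (congrFun h i₀), rfl⟩
    · simpa [Finset.image_insert] using ht i
  exact ⟨z, z', (hproper z hz).1, (hproper z hz).2.1, hne, (hproper z hz).2.2,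
    (hproper z' hz').2.2⟩

end Tensor

section Construction

variable {n : ℕ}

open Classical in
/-- The 3-graph of all triples `i < j < k` such that `r i j` holds while `r i k` and `r j k` fail. -/
noncomputable def paletteGraph (r : Fin n → Fin n → Prop) : ThreeGraph (Fin n) where
  edges := Finset.univ.filter (fun e : Finset (Fin n) =>
    ∃ i j k, i < j ∧ j < k ∧ r i j ∧ ¬ r i k ∧ ¬ r j k ∧ e = {i, j, k})
  card_eq := by
    intro e he
    obtain ⟨i, j, k, hij, hjk, -, -, -, rfl⟩ := (mem_filter.1 he).2
    exact Finset.card_eq_three.2 ⟨i, j, k, hij.ne, (hij.trans hjk).ne, hjk.ne, rfl⟩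

lemma mem_paletteGraph_edges {r : Fin n → Fin n → Prop} {e : Finset (Fin n)} :
    e ∈ (paletteGraph r).edges ↔
      ∃ i j k, i < j ∧ j < k ∧ r i j ∧ ¬ r i k ∧ ¬ r j k ∧ e = {i, j, k} := by
  simp [paletteGraph]

lemma paletteGraph_edge_cases {r : Fin n → Fin n → Prop} {p q s : Fin n} (hpq : p < q)
    (h : ({p, q, s} : Finset (Fin n)) ∈ (paletteGraph r).edges) :
    (r p q ∧ q < s) ∨ (¬ r p q ∧ p < s ∧ s < q ∧ r p s) ∨ (¬ r p q ∧ s < p ∧ r s p) := by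
  obtain ⟨i, j, k, hij, hjk, h1, h2, h3, he⟩ := mem_paletteGraph_edges.1 h
  have hp : p = i ∨ p = j ∨ p = k := by
    have : p ∈ ({i, j, k} : Finset (Fin n)) := he ▸ (by simp)
    simpa using this
  have hq : q = i ∨ q = j ∨ q = k := by
    have : q ∈ ({i, j, k} : Finset (Fin n)) := he ▸ (by simp)
    simpa using this
  have hi : i = p ∨ i = q ∨ i = s := by
    have : i ∈ ({p, q, s} : Finset (Fin n)) := he ▸ (by simp)
    simpa using this
  have hj : j = p ∨ j = q ∨ j = s := by
    have : j ∈ ({p, q, s} : Finset (Fin n)) := he ▸ (by simp)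
    simpa using this
  have hk : k = p ∨ k = q ∨ k = s := by
    have : k ∈ ({p, q, s} : Finset (Fin n)) := he ▸ (by simp)
    simpa using this
  clear h he
  rcases hp with rfl | rfl | rfl <;> rcases hq with rfl | rfl | rfl <;> grind

theorem not_hasCopy_paletteGraph_tensorGraph {k : ℕ} (hk : 4 ≤ k) (r : Fin n → Fin n → Prop) :
    ¬ HasCopy (paletteGraph r) (tensorGraph k) := by
  classical
  rintro ⟨φ, hinj, hφ⟩
  have hne : ∀ {x y : CodegTwoFamily k → Fin k}, (∀ i, x i ≠ y i) → φ x ≠ φ y := by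
    intro x y h he
    obtain ⟨i₀⟩ := codegTwoFamily_nonempty hk
    exact h i₀ (congrFun (hinj he) i₀)
  have hedge : ∀ {x y z : CodegTwoFamily k → Fin k},
      ({x, y, z} : Finset _) ∈ (tensorGraph k).edges →
      ({φ x, φ y, φ z} : Finset (Fin n)) ∈ (paletteGraph r).edges := by
    intro x y z h
    simpa [Finset.image_insert] using hφ _ h
  -- Every pair differing in all coordinates extends to a pair satisfying `r`, unless it does so
  -- itself, and the larger vertex of the new pair is at least the smaller one of the old pair.
  have hred : ∀ x y : CodegTwoFamily k → Fin k, (∀ i, x i ≠ y i) → φ x < φ y →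
      ∃ u v : CodegTwoFamily k → Fin k, (∀ i, u i ≠ v i) ∧ φ u < φ v ∧ r (φ u) (φ v) ∧
        φ x ≤ φ v := by
    intro x y hxy hlt
    obtain ⟨z, -, hxz, hyz, -, hz, -⟩ := tensorGraph_exists_two_extensions hk hxy
    rcases paletteGraph_edge_cases hlt (hedge hz) with ⟨h, -⟩ | ⟨-, h1, -, h2⟩ | ⟨-, h1, h2⟩
    · exact ⟨x, y, hxy, hlt, h, hlt.le⟩
    · exact ⟨x, z, hxz, h1, h2, h1.le⟩
    · exact ⟨z, x, fun i => (hxz i).symm, h1, h2, le_rfl⟩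
  have hred' : ∀ x y : CodegTwoFamily k → Fin k, (∀ i, x i ≠ y i) →
      ∃ u v : CodegTwoFamily k → Fin k, (∀ i, u i ≠ v i) ∧ φ u < φ v ∧ r (φ u) (φ v) ∧
        min (φ x) (φ y) ≤ φ v := by
    intro x y hxy
    rcases lt_or_gt_of_ne (hne hxy) with h | h
    · simpa [min_eq_left h.le] using hred x y hxy h
    · simpa [min_eq_right h.le] using hred y x (fun i => (hxy i).symm) h
  let S : Finset ((CodegTwoFamily k → Fin k) × (CodegTwoFamily k → Fin k)) :=
    Finset.univ.filter (fun p => (∀ i, p.1 i ≠ p.2 i) ∧ φ p.1 < φ p.2 ∧ r (φ p.1) (φ p.2))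
  have hS : S.Nonempty := by
    obtain ⟨u, v, h1, h2, h3, -⟩ := hred' (fun _ => ⟨0, by omega⟩) (fun _ => ⟨1, by omega⟩)
      (fun i => by simp)
    exact ⟨(u, v), by simp [S, h1, h2, h3]⟩
  obtain ⟨⟨u, v⟩, huv, hmax⟩ := S.exists_max_image (fun p => φ p.2) hS
  obtain ⟨h1, h2, h3⟩ := (mem_filter.1 huv).2
  obtain ⟨z, z', -, -, hzz', hz, hz'⟩ := tensorGraph_exists_two_extensions hk h1
  have above : ∀ {t : CodegTwoFamily k → Fin k},
      ({u, v, t} : Finset _) ∈ (tensorGraph k).edges → φ v < φ t := by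
    intro t ht
    rcases paletteGraph_edge_cases h2 (hedge ht) with ⟨-, h⟩ | ⟨h, -⟩ | ⟨h, -⟩
    · exact h
    · exact absurd h3 h
    · exact absurd h3 h
  obtain ⟨u', v', h1', h2', h3', hle⟩ := hred' z z' hzz'
  have hle' : φ v' ≤ φ v := hmax (u', v') (by simp [S, h1', h2', h3'])
  exact absurd (lt_of_lt_of_le (lt_min (above hz) (above hz')) (hle.trans hle')) (lt_irrefl _)

lemma sum_indicator_le_card_edges (r : Fin n → Fin n → Prop) [DecidableRel r]
    (U : Finset (Fin n)) :
    (∑ i ∈ U, ∑ j ∈ U, ∑ k ∈ U,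
      if i < j ∧ j < k ∧ r i j ∧ ¬ r i k ∧ ¬ r j k then (1 : ℝ) else 0) ≤
      (((paletteGraph r).edges.filter (fun e => e ⊆ U)).card : ℝ) := by
  have hcard : (∑ i ∈ U, ∑ j ∈ U, ∑ k ∈ U,
      if i < j ∧ j < k ∧ r i j ∧ ¬ r i k ∧ ¬ r j k then (1 : ℝ) else 0) =
      (((U ×ˢ U ×ˢ U).filter (fun p => p.1 < p.2.1 ∧ p.2.1 < p.2.2 ∧ r p.1 p.2.1 ∧
        ¬ r p.1 p.2.2 ∧ ¬ r p.2.1 p.2.2)).card : ℝ) := by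
    rw [Finset.card_filter]
    push_cast
    rw [Finset.sum_product]
    simp_rw [Finset.sum_product]
  rw [hcard]
  norm_cast
  refine Finset.card_le_card_of_injOn (fun p => {p.1, p.2.1, p.2.2}) ?_ ?_
  · rintro ⟨i, j, k⟩ hp
    simp only [coe_filter, mem_product, Set.mem_ofPred_eq] at hp ⊢
    obtain ⟨⟨hi, hj, hk⟩, h1, h2, h3, h4, h5⟩ := hp
    refine ⟨mem_paletteGraph_edges.2 ⟨i, j, k, h1, h2, h3, h4, h5, rfl⟩, ?_⟩
    simp [Finset.insert_subset_iff, hi, hj, hk]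
  · rintro ⟨i, j, k⟩ hp ⟨i', j', k'⟩ hp' he
    simp only [coe_filter, mem_product, Set.mem_ofPred_eq] at hp hp' he
    obtain ⟨-, h1, h2, -⟩ := hp
    obtain ⟨-, h1', h2', -⟩ := hp'
    have hmem : ∀ t, (t = i ∨ t = j ∨ t = k) ↔ (t = i' ∨ t = j' ∨ t = k') := by
      intro t
      have := Finset.ext_iff.1 he t
      simpa using this
    have hi := (hmem i).1 (by simp)
    have hj := (hmem j).1 (by simp)
    have hk := (hmem k).1 (by simp)
    have hi' := (hmem i').2 (by simp)
    have hk' := (hmem k').2 (by simp)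
    grind

lemma choose_three_le_sum_indicator (U : Finset (Fin n)) :
    (U.card.choose 3 : ℝ) ≤ ∑ i ∈ U, ∑ j ∈ U, ∑ k ∈ U, if i < j ∧ j < k then (1 : ℝ) else 0 := by
  have hcard : (∑ i ∈ U, ∑ j ∈ U, ∑ k ∈ U, if i < j ∧ j < k then (1 : ℝ) else 0) =
      (((U ×ˢ U ×ˢ U).filter (fun p => p.1 < p.2.1 ∧ p.2.1 < p.2.2)).card : ℝ) := by
    rw [Finset.card_filter]
    push_cast
    rw [Finset.sum_product]
    simp_rw [Finset.sum_product]
  rw [hcard, ← Finset.card_powersetCard]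
  norm_cast
  refine Finset.card_le_card_of_surjOn (fun p => {p.1, p.2.1, p.2.2}) ?_
  intro e he
  obtain ⟨heU, he3⟩ := Finset.mem_powersetCard.1 he
  let f := e.orderEmbOfFin he3
  have hf : ∀ a, f a ∈ U := fun a => heU (e.orderEmbOfFin_mem he3 a)
  refine ⟨(f 0, f 1, f 2), ?_, ?_⟩
  · simp only [coe_filter, mem_product, Set.mem_ofPred_eq]
    exact ⟨⟨hf 0, hf 1, hf 2⟩, f.strictMono (by decide), f.strictMono (by decide)⟩
  · have himage : Finset.univ.image f = e := Finset.image_orderEmbOfFin_univ e he3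
    rw [← himage]
    ext t
    simp [Fin.exists_fin_succ, eq_comm]

end Construction

section Discrepancy

variable {ι : Type*} [Fintype ι]

/-- A bound on the cut norm of a real matrix in terms of its four-cycle count. -/
lemma bilinear_pow_four_le (F : ι → ι → ℝ) (a b : ι → ℝ) (ha : ∀ i, |a i| ≤ 1)
    (hb : ∀ i, |b i| ≤ 1) :
    (∑ i, ∑ j, a i * b j * F i j) ^ 4 ≤
      (Fintype.card ι : ℝ) ^ 4 * ∑ j, ∑ j', (∑ i, F i j * F i j') ^ 2 := by
  set N : ℝ := (Fintype.card ι : ℝ) with hN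
  have ha2 : ∀ i, a i ^ 2 ≤ 1 := fun i => (sq_le_one_iff_abs_le_one _).2 (ha i)
  have hb2 : ∀ i, b i ^ 2 ≤ 1 := fun i => (sq_le_one_iff_abs_le_one _).2 (hb i)
  have hN0 : 0 ≤ N := by positivity
  have hfirst : (∑ i, ∑ j, a i * b j * F i j) ^ 2 ≤ N * ∑ i, (∑ j, b j * F i j) ^ 2 := by
    have hrew : (∑ i, ∑ j, a i * b j * F i j) = ∑ i, a i * ∑ j, b j * F i j := by
      simp_rw [Finset.mul_sum, mul_assoc]
    rw [hrew]
    refine (Finset.sum_mul_sq_le_sq_mul_sq _ _ _).trans ?_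
    refine mul_le_mul_of_nonneg_right ?_ (Finset.sum_nonneg fun i _ => sq_nonneg _)
    refine (Finset.sum_le_sum fun i _ => ha2 i).trans ?_
    simp [hN]
  have hexpand : ∑ i, (∑ j, b j * F i j) ^ 2 =
      ∑ p : ι × ι, (b p.1 * b p.2) * ∑ i, F i p.1 * F i p.2 := by
    rw [Fintype.sum_prod_type]
    simp_rw [sq, Finset.sum_mul_sum, Finset.mul_sum]
    rw [Finset.sum_comm]
    refine Finset.sum_congr rfl fun j _ => ?_
    rw [Finset.sum_comm]
    exact Finset.sum_congr rfl fun j' _ => Finset.sum_congr rfl fun i _ => by ring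
  have hsecond : (∑ i, (∑ j, b j * F i j) ^ 2) ^ 2 ≤
      N ^ 2 * ∑ j, ∑ j', (∑ i, F i j * F i j') ^ 2 := by
    rw [hexpand]
    refine (Finset.sum_mul_sq_le_sq_mul_sq _ _ _).trans ?_
    rw [← Fintype.sum_prod_type' (f := fun j j' => (∑ i, F i j * F i j') ^ 2)]
    refine mul_le_mul_of_nonneg_right ?_ (Finset.sum_nonneg fun i _ => sq_nonneg _)
    refine (Finset.sum_le_sum (g := fun _ => (1 : ℝ)) fun p _ => ?_).trans ?_
    · rw [mul_pow]
      exact mul_le_one₀ (hb2 _) (sq_nonneg _) (hb2 _)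
    · simp [hN, sq]
  calc (∑ i, ∑ j, a i * b j * F i j) ^ 4
      = ((∑ i, ∑ j, a i * b j * F i j) ^ 2) ^ 2 := by ring
    _ ≤ (N * ∑ i, (∑ j, b j * F i j) ^ 2) ^ 2 := by gcongr
    _ = N ^ 2 * (∑ i, (∑ j, b j * F i j) ^ 2) ^ 2 := by ring
    _ ≤ N ^ 2 * (N ^ 2 * ∑ j, ∑ j', (∑ i, F i j * F i j') ^ 2) := by gcongr
    _ = _ := by ring

/-- The indicator function of `0` in `ZMod 3`, shifted to have mean zero. -/
noncomputable def balanced (t : ZMod 3) : ℝ := (if t = 0 then 1 else 0) - 1 / 3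

lemma abs_balanced_le_one (t : ZMod 3) : |balanced t| ≤ 1 := by
  unfold balanced
  split_ifs <;> norm_num [abs_le]

lemma sum_balanced_add (s : ZMod 3) : ∑ t : ZMod 3, balanced (s + t) = 0 := by
  refine (Equiv.sum_comp (Equiv.addLeft s) balanced).trans ?_
  have : (univ : Finset (ZMod 3)) = {0, 1, 2} := by decide
  rw [this]
  unfold balanced
  rw [Finset.sum_insert (by decide), Finset.sum_insert (by decide), Finset.sum_singleton,
    if_pos rfl, if_neg (by decide), if_neg (by decide)]
  norm_num

lemma sum_balanced_mul_eq_zero {κ : Type*} [Fintype κ] [DecidableEq κ] (p : κ)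
    (h : (κ → ZMod 3) → ℝ) (hh : ∀ c t, h (c + Pi.single p t) = h c) :
    ∑ c : κ → ZMod 3, balanced (c p) * h c = 0 := by
  have hshift : ∀ t : ZMod 3, ∑ c : κ → ZMod 3, balanced (c p) * h c =
      ∑ c : κ → ZMod 3, balanced (c p + t) * h c := by
    intro t
    rw [← Equiv.sum_comp (Equiv.addRight (Pi.single p t : κ → ZMod 3))]
    refine Finset.sum_congr rfl fun c _ => ?_
    simp [hh]
  have hthree : ∑ _t : ZMod 3, ∑ c : κ → ZMod 3, balanced (c p) * h c = 0 := by
    rw [Finset.sum_congr rfl fun t _ => hshift t, Finset.sum_comm]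
    refine Finset.sum_eq_zero fun c _ => ?_
    rw [← Finset.sum_mul, sum_balanced_add, zero_mul]
  simpa using hthree

/-- Some three-colouring of the pairs makes the upper triangular part of the balanced indicator
matrix have a small four-cycle count. -/
lemma exists_colouring_fourCycle_le (n : ℕ) : ∃ c : Fin n × Fin n → ZMod 3,
    ∑ j, ∑ j', (∑ i, (if i < j then balanced (c (i, j)) else 0) *
      (if i < j' then balanced (c (i, j')) else 0)) ^ 2 ≤ 2 * (n : ℝ) ^ 3 := by
  set F : (Fin n × Fin n → ZMod 3) → Fin n → Fin n → ℝ :=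
    fun c i j => if i < j then balanced (c (i, j)) else 0 with hF
  have hF1 : ∀ c i j, |F c i j| ≤ 1 := by
    intro c i j
    simp only [hF]
    split_ifs
    · exact abs_balanced_le_one _
    · simp
  have hterm : ∀ j j' i i' : Fin n, ∑ c, F c i j * F c i j' * (F c i' j * F c i' j') ≤
      ∑ _c : Fin n × Fin n → ZMod 3,
        ((if i = i' then (1 : ℝ) else 0) + (if j = j' then 1 else 0)) := by
    intro j j' i i'
    by_cases hdeg : i = i' ∨ j = j'
    · refine Finset.sum_le_sum fun c _ => ?_
      have hle : F c i j * F c i j' * (F c i' j * F c i' j') ≤ 1 := by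
        refine (le_abs_self _).trans ?_
        rw [abs_mul, abs_mul, abs_mul]
        exact mul_le_one₀ (mul_le_one₀ (hF1 _ _ _) (abs_nonneg _) (hF1 _ _ _)) (by positivity)
          (mul_le_one₀ (hF1 _ _ _) (abs_nonneg _) (hF1 _ _ _))
      refine hle.trans ?_
      rcases hdeg with h | h
      · rw [if_pos h]
        split_ifs <;> norm_num
      · rw [if_pos h]
        split_ifs <;> norm_num
    · push Not at hdeg
      obtain ⟨hi, hj⟩ := hdeg
      have hzero : ∑ c, F c i j * F c i j' * (F c i' j * F c i' j') = 0 := by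
        by_cases hij : i < j
        · have := sum_balanced_mul_eq_zero (i, j)
            (fun c => F c i j' * (F c i' j * F c i' j')) (fun c t => by
              simp only [hF, Pi.add_apply]
              rw [Pi.single_eq_of_ne (by simp [Ne.symm hj]),
                Pi.single_eq_of_ne (by simp [Ne.symm hi]),
                Pi.single_eq_of_ne (by simp [Ne.symm hi])]
              simp)
          rw [← this]
          refine Finset.sum_congr rfl fun c _ => ?_
          simp only [hF, if_pos hij]
          ring
        · refine Finset.sum_eq_zero fun c _ => ?_
          simp [hF, hij]
      rw [hzero]
      refine Finset.sum_nonneg fun c _ => ?_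
      split_ifs <;> norm_num
  have hsum : ∑ c, ∑ j, ∑ j', (∑ i, F c i j * F c i j') ^ 2 ≤
      ∑ _c : Fin n × Fin n → ZMod 3, 2 * (n : ℝ) ^ 3 := by
    calc ∑ c, ∑ j, ∑ j', (∑ i, F c i j * F c i j') ^ 2
        = ∑ j, ∑ j', ∑ i, ∑ i', ∑ c, F c i j * F c i j' * (F c i' j * F c i' j') := by
          simp_rw [sq, Finset.sum_mul_sum]
          rw [Finset.sum_comm]
          refine Finset.sum_congr rfl fun j _ => ?_
          rw [Finset.sum_comm]
          refine Finset.sum_congr rfl fun j' _ => ?_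
          rw [Finset.sum_comm]
          refine Finset.sum_congr rfl fun i _ => ?_
          rw [Finset.sum_comm]
      _ ≤ ∑ j : Fin n, ∑ j' : Fin n, ∑ i : Fin n, ∑ i' : Fin n,
          ∑ _c : Fin n × Fin n → ZMod 3,
            ((if i = i' then (1 : ℝ) else 0) + (if j = j' then 1 else 0)) :=
          Finset.sum_le_sum fun j _ => Finset.sum_le_sum fun j' _ =>
            Finset.sum_le_sum fun i _ => Finset.sum_le_sum fun i' _ => hterm j j' i i'
      _ = ∑ _c : Fin n × Fin n → ZMod 3, 2 * (n : ℝ) ^ 3 := by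
          simp only [Finset.sum_const, nsmul_eq_mul, ← Finset.mul_sum]
          congr 1
          simp [Finset.sum_add_distrib]
          ring
  obtain ⟨c, -, hc⟩ := Finset.exists_le_of_sum_le Finset.univ_nonempty hsum
  exact ⟨c, hc⟩

end Discrepancy

section Density

variable {n : ℕ}

/-- If the upper triangular part of the balanced matrix has cut norm at most `K`, the associated
palette graph is uniformly dense with density `4 / 27`. -/
lemma palette_count_lower_bound (c : Fin n × Fin n → ZMod 3) {K : ℝ}
    (hK : ∀ a b : Fin n → ℝ, (∀ i, |a i| ≤ 1) → (∀ i, |b i| ≤ 1) →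
      |∑ i, ∑ j, a i * b j * (if i < j then balanced (c (i, j)) else 0)| ≤ K)
    (U : Finset (Fin n)) :
    4 / 27 * (U.card.choose 3 : ℝ) - 2 * n * K ≤
      (((paletteGraph fun i j => c (i, j) = 0).edges.filter (fun e => e ⊆ U)).card : ℝ) := by
  set F : Fin n → Fin n → ℝ := fun i j => if i < j then balanced (c (i, j)) else 0 with hF
  let χ : Fin n → ℝ := fun i => if i ∈ U then 1 else 0
  let T : Fin n → Fin n → ℝ := fun i j => if i < j then 1 else 0
  let B : Fin n → Fin n → ℝ := fun i j => if c (i, j) = 0 then 0 else 1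
  have habs : ∀ {p : Prop} [Decidable p], |(if p then (1 : ℝ) else 0)| ≤ 1 := by
    intro p _
    split_ifs <;> simp
  have hχ : ∀ i, |χ i| ≤ 1 := fun i => habs
  have hT : ∀ i j, |T i j| ≤ 1 := fun i j => habs
  have hB : ∀ i j, |B i j| ≤ 1 := by
    intro i j
    simp only [B]
    split_ifs <;> simp
  have hmul : ∀ {x y : ℝ}, |x| ≤ 1 → |y| ≤ 1 → |x * y| ≤ 1 := by
    intro x y hx hy
    rw [abs_mul]
    exact mul_le_one₀ hx (abs_nonneg _) hy
  have hsumK : ∀ a b : Fin n → Fin n → ℝ, (∀ l i, |a l i| ≤ 1) → (∀ l i, |b l i| ≤ 1) →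
      ∀ w : Fin n → ℝ, (∀ l, |w l| ≤ 1) →
      |∑ l, w l * ∑ i, ∑ j, a l i * b l j * F i j| ≤ n * K := by
    intro a b ha hb w hw
    refine (Finset.abs_sum_le_sum_abs _ _).trans ?_
    refine (Finset.sum_le_sum (g := fun _ => K) fun l _ => ?_).trans (by simp)
    rw [abs_mul]
    have := hK (a l) (b l) (ha l) (hb l)
    exact (mul_le_of_le_one_left (abs_nonneg _) (hw l)).trans this
  have hX := hsumK (fun k i => χ i * (T i k * B i k)) (fun k j => χ j * (T j k * B j k))
    (fun _ _ => hmul (hχ _) (hmul (hT _ _) (hB _ _)))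
    (fun _ _ => hmul (hχ _) (hmul (hT _ _) (hB _ _))) χ hχ
  have hY := hsumK (fun j i => χ i * T i j) (fun j k => χ k * (T j k * B j k))
    (fun _ _ => hmul (hχ _) (hT _ _)) (fun _ _ => hmul (hχ _) (hmul (hT _ _) (hB _ _))) χ hχ
  have hZ := hsumK (fun i j => χ j * T i j) (fun _ k => χ k)
    (fun _ _ => hmul (hχ _) (hT _ _)) (fun _ _ => hχ _) χ hχ
  have hnK : 0 ≤ n * K := (abs_nonneg _).trans hX
  set X := ∑ k, χ k * ∑ i, ∑ j, χ i * (T i k * B i k) * (χ j * (T j k * B j k)) * F i j with hXdef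
  set Y := ∑ j, χ j * ∑ i, ∑ k, χ i * T i j * (χ k * (T j k * B j k)) * F i k with hYdef
  set Z := ∑ i, χ i * ∑ j, ∑ k, χ j * T i j * χ k * F j k with hZdef
  have hX' : X = ∑ i, ∑ j, ∑ k, χ k *
      (χ i * (T i k * B i k) * (χ j * (T j k * B j k)) * F i j) := by
    simp_rw [hXdef, Finset.mul_sum]
    rw [Finset.sum_comm]
    exact Finset.sum_congr rfl fun i _ => Finset.sum_comm
  have hY' : Y = ∑ i, ∑ j, ∑ k, χ j * (χ i * T i j * (χ k * (T j k * B j k)) * F i k) := by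
    simp_rw [hYdef, Finset.mul_sum]
    rw [Finset.sum_comm]
  have hZ' : Z = ∑ i, ∑ j, ∑ k, χ i * (χ j * T i j * χ k * F j k) := by
    simp_rw [hZdef, Finset.mul_sum]
  have hχsum : ∀ f : Fin n → ℝ, ∑ i ∈ U, f i = ∑ i, χ i * f i := by
    intro f
    simp [χ]
  have hcount : (∑ i ∈ U, ∑ j ∈ U, ∑ k ∈ U,
      if i < j ∧ j < k ∧ c (i, j) = 0 ∧ ¬ c (i, k) = 0 ∧ ¬ c (j, k) = 0 then (1 : ℝ) else 0) =
      4 / 27 * (∑ i ∈ U, ∑ j ∈ U, ∑ k ∈ U, if i < j ∧ j < k then (1 : ℝ) else 0) +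
        (X - 1 / 3 * Y - 2 / 9 * Z) := by
    rw [hX', hY', hZ']
    simp only [hχsum, Finset.mul_sum, ← Finset.sum_sub_distrib, ← Finset.sum_add_distrib]
    refine Finset.sum_congr rfl fun i _ => Finset.sum_congr rfl fun j _ =>
      Finset.sum_congr rfl fun k _ => ?_
    by_cases hij : i < j
    · by_cases hjk : j < k
      · have hik := hij.trans hjk
        simp only [hF, T, B, balanced, hij, hjk, hik, if_true, true_and]
        by_cases h1 : c (i, j) = 0 <;> by_cases h2 : c (i, k) = 0 <;>
          by_cases h3 : c (j, k) = 0 <;> simp [h1, h2, h3] <;> ring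
      · simp [hF, T, hjk]
    · simp [hF, T, hij]
  have hedges := sum_indicator_le_card_edges (fun i j => c (i, j) = 0) U
  have hchoose := choose_three_le_sum_indicator U
  rw [hcount] at hedges
  have h1 := abs_le.1 hX
  have h2 := abs_le.1 hY
  have h3 := abs_le.1 hZ
  linarith [h1.1, h2.2, h3.2]

lemma exists_uniformlyDense_paletteGraph {η : ℝ} (hη : 0 < η) (hn : 32 / η ^ 4 ≤ n) :
    ∃ r : Fin n → Fin n → Prop, UniformlyDense (paletteGraph r) (4 / 27) η := by
  obtain ⟨c, hc⟩ := exists_colouring_fourCycle_le n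
  refine ⟨fun i j => c (i, j) = 0, fun U => ?_⟩
  have hbound := palette_count_lower_bound c (K := η * n ^ 2 / 2) (fun a b ha hb => ?_) U
  · refine le_trans (le_of_eq ?_) hbound
    ring
  · have h4 := bilinear_pow_four_le (fun i j => if i < j then balanced (c (i, j)) else 0) a b ha hb
    rw [Fintype.card_fin] at h4
    refine abs_le_of_sq_le_sq' ?_ (by positivity) |> abs_le.2
    refine le_of_sq_le_sq ?_ (by positivity)
    have hn' : 32 ≤ n * η ^ 4 := (div_le_iff₀ (by positivity)).1 hn
    calc _ = _ := by rw [← pow_mul]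
      _ ≤ _ := h4
      _ ≤ (n : ℝ) ^ 4 * (2 * (n : ℝ) ^ 3) := by gcongr
      _ = (n : ℝ) ^ 7 / 16 * 32 := by ring
      _ ≤ (n : ℝ) ^ 7 / 16 * (n * η ^ 4) := by gcongr
      _ = ((η * n ^ 2 / 2) ^ 2) ^ 2 := by ring

end Density

/-- For every `k ≥ 4`, the tensor product 3-graph `F̃_k` has uniform Turán density
at least `4/27`. -/
theorem stmt7 (k : ℕ) (hk : 4 ≤ k) : 4 / 27 ≤ piUnif (tensorGraph k) := by
  refine le_csSup ⟨1, fun d hd => hd.2.1⟩ ⟨by norm_num, by norm_num, fun η hη n₀ => ?_⟩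
  obtain ⟨m, hm⟩ := exists_nat_ge (32 / η ^ 4)
  have hn : 32 / η ^ 4 ≤ ((max m n₀ : ℕ) : ℝ) := hm.trans (by exact_mod_cast le_max_left m n₀)
  obtain ⟨r, hr⟩ := exists_uniformlyDense_paletteGraph hη hn
  exact ⟨max m n₀, le_max_right _ _, paletteGraph r,
    not_hasCopy_paletteGraph_tensorGraph hk r, hr⟩
end
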